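/- Let G be a connected C_4-free graph of order n with minimum degree δ and maximum degree Δ. Set ε_Δ = Δδ − 2⌊Δ/2⌋ + 1 and ε_δ = δ² − 2⌊δ/2⌋ + 1. Then avec(G) ≤ (15/4)·((n − ε_Δ + ε_δ)/ε_δ)·(1 + (ε_Δ − ε_δ)/(3n)) + 37/4. -/

import Mathlib

open SimpleGraph Finset

noncomputable def ecc {V : Type*} [Fintype V] (G : SimpleGraph V) (v : V) : ℕ :=
  Finset.univ.sup (G.dist v)

noncomputable def avec {V : Type*} [Fintype V] (G : SimpleGraph V) : ℝ :=
  (∑ v, (ecc G v : ℝ)) / (Fintype.card V)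

/-- G contains no 4-cycle as a (not necessarily induced) subgraph. -/
def C4Free {V : Type*} (G : SimpleGraph V) : Prop :=
  ¬ ∃ a b c d : V, a ≠ c ∧ b ≠ d ∧ G.Adj a b ∧ G.Adj b c ∧ G.Adj c d ∧ G.Adj d a

section helpers

variable {V : Type*} [Fintype V] {G : SimpleGraph V}

lemma geo_aux (hG : G.Connected) (u v : V) (i : ℕ) (hi : i ≤ G.dist u v) :
    ∃ w, G.dist u w = i ∧ i + G.dist w v = G.dist u v := by
  obtain ⟨p, hp⟩ := hG.exists_walk_length_eq_dist u v
  have h1 : G.dist u (p.getVert i) ≤ i := by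
    refine (dist_le (p.take i)).trans ?_
    simp
  have h2 : G.dist (p.getVert i) v ≤ p.length - i := by
    refine (dist_le (p.drop i)).trans ?_
    simp
  have h3 : G.dist u v ≤ G.dist u (p.getVert i) + G.dist (p.getVert i) v := hG.dist_triangle
  exact ⟨p.getVert i, by omega, by omega⟩

lemma dist_le_ecc (u v : V) : G.dist u v ≤ ecc G u := Finset.le_sup (Finset.mem_univ v)

lemma exists_ecc (hG : G.Connected) (u : V) : ∃ v, G.dist u v = ecc G u := by
  have := hG.nonempty
  obtain ⟨v, -, hv⟩ := Finset.exists_mem_eq_sup (Finset.univ : Finset V)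
    Finset.univ_nonempty (G.dist u)
  exact ⟨v, hv.symm⟩

lemma ecc_lt_card (hG : G.Connected) (u : V) : ecc G u + 1 ≤ Fintype.card V := by
  obtain ⟨v, hv⟩ := exists_ecc hG u
  obtain ⟨p, hp, hl⟩ := hG.exists_path_of_dist u v
  have := hp.length_lt
  omega

lemma level_two (hG : G.Connected) (c : V) (hc : ∀ v, ecc G c ≤ ecc G v) (i : ℕ)
    (hi : 1 ≤ i) (hir : i < ecc G c) :
    2 ≤ (Finset.univ.filter (fun v => G.dist c v = i)).card := by
  by_contra hlt
  have h1 : (Finset.univ.filter (fun v => G.dist c v = i)).card ≤ 1 := by omega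
  rw [Finset.card_le_one] at h1
  obtain ⟨v0, hv0⟩ := exists_ecc hG c
  obtain ⟨w, hw, -⟩ := geo_aux hG c v0 i (by omega)
  obtain ⟨c', hc', hcw⟩ := geo_aux hG c w 1 (by omega)
  have key : ∀ v, G.dist c' v ≤ ecc G c - 1 := by
    intro v
    have hv := dist_le_ecc (G := G) c v
    by_cases h : G.dist c v < i
    · have h3 : G.dist c' v ≤ G.dist c' c + G.dist c v := hG.dist_triangle
      rw [dist_comm (u := c') (v := c)] at h3
      omega
    · obtain ⟨w', hw', hw2⟩ := geo_aux hG c v i (by omega)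
      have : w' = w := h1 w' (by simp [hw']) w (by simp [hw])
      subst this
      have h3 : G.dist c' v ≤ G.dist c' w' + G.dist w' v := hG.dist_triangle
      omega
  have h4 : ecc G c' ≤ ecc G c - 1 := Finset.sup_le (fun v _ => key v)
  have := hc c'
  omega

lemma levels_lt (hG : G.Connected) (c : V) (hc : ∀ v, ecc G c ≤ ecc G v) (j : ℕ)
    (hjr : j < ecc G c) :
    2 * j + 1 ≤ (Finset.univ.filter (fun v => G.dist c v ≤ j)).card := by
  classical
  induction j with
  | zero =>
    have : 0 < (Finset.univ.filter (fun v => G.dist c v ≤ 0)).card :=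
      Finset.card_pos.mpr ⟨c, by simp⟩
    omega
  | succ j ih =>
    have h1 := ih (by omega)
    have h2 := level_two hG c hc (j + 1) (by omega) hjr
    have h3 : (Finset.univ.filter (fun v => G.dist c v ≤ j + 1)) =
        (Finset.univ.filter (fun v => G.dist c v ≤ j)) ∪
        (Finset.univ.filter (fun v => G.dist c v = j + 1)) := by
      ext v; simp; omega
    rw [h3, Finset.card_union_of_disjoint]
    · omega
    · rw [Finset.disjoint_filter]; intro v _ _; omega

lemma sum_ecc_le (hG : G.Connected) :
    4 * ∑ v, ecc G v ≤ 3 * (Fintype.card V) ^ 2 := by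
  classical
  have := hG.nonempty
  obtain ⟨c, hc⟩ := Finite.exists_min (ecc G)
  set r := ecc G c with hr
  set k := Fintype.card V with hk
  have h1 : ∑ v, ecc G v ≤ k * r + ∑ v, G.dist c v := by
    have : ∑ v, ecc G v ≤ ∑ v, (r + G.dist c v) := by
      refine Finset.sum_le_sum (fun v _ => Finset.sup_le (fun w _ => ?_))
      have h3 : G.dist v w ≤ G.dist v c + G.dist c w := hG.dist_triangle
      rw [dist_comm (u := v) (v := c)] at h3
      have := dist_le_ecc (G := G) c w
      omega
    simpa [Finset.sum_add_distrib] using this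
  have h2 : ∑ v, G.dist c v = ∑ j ∈ Finset.range r,
      (Finset.univ.filter (fun v => j < G.dist c v)).card := by
    simp_rw [Finset.card_filter]
    rw [Finset.sum_comm]
    refine Finset.sum_congr rfl (fun v _ => ?_)
    rw [← Finset.card_filter]
    have hv := dist_le_ecc (G := G) c v
    have : (Finset.range r).filter (fun j => j < G.dist c v) = Finset.range (G.dist c v) := by
      ext j; simp; omega
    rw [this, Finset.card_range]
  have h3 : ∀ j ∈ Finset.range r,
      (Finset.univ.filter (fun v => j < G.dist c v)).card + (2 * j + 1) ≤ k := by
    intro j hj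
    have h4 := levels_lt hG c hc j (by simpa using hj)
    have h5 := Finset.card_filter_add_card_filter_not (s := (Finset.univ : Finset V))
      (fun v => G.dist c v ≤ j)
    simp only [not_le, Finset.card_univ] at h5
    omega
  have h4 := Finset.sum_le_sum h3
  rw [Finset.sum_add_distrib, ← h2] at h4
  have h5 : ∀ m : ℕ, ∑ j ∈ Finset.range m, (2 * j + 1) = m ^ 2 := by
    intro m
    induction m with
    | zero => simp
    | succ m ih => rw [Finset.sum_range_succ, ih]; ring
  rw [h5] at h4
  simp at h4
  have h6 : 2 * r ≤ k := by
    rcases Nat.eq_zero_or_pos r with h0 | h0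
    · omega
    · have h7 := h3 (r - 1) (by simp; omega)
      obtain ⟨v0, hv0⟩ := exists_ecc hG c
      have h8 : 0 < (Finset.univ.filter (fun v => r - 1 < G.dist c v)).card :=
        Finset.card_pos.mpr ⟨v0, by simp; omega⟩
      omega
  zify at *
  nlinarith [mul_nonneg (sub_nonneg.mpr h6) (sub_nonneg.mpr (show (2 * (r : ℤ)) ≤ 3 * k by linarith))]

lemma ball_card [DecidableRel G.Adj] (hG : G.Connected) (hfree : C4Free G) (v : V) :
    G.degree v * G.minDegree + 1 ≤
      (Finset.univ.filter (fun u => G.dist v u ≤ 2)).card + 2 * (G.degree v / 2) := by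
  classical
  set N := G.neighborFinset v with hN
  let m : V → ℕ := fun w => (N ∩ G.neighborFinset w).card
  let T : V → Finset V := fun w => G.neighborFinset w \ insert v N
  have hm1 : ∀ w ∈ N, m w ≤ 1 := by
    intro w hw
    refine Finset.card_le_one.mpr (fun a ha b hb => ?_)
    by_contra hab
    simp [hN] at ha hb hw
    exact hfree ⟨v, a, w, b, hw.ne, hab, ha.1, ha.2.symm, hb.2, hb.1.symm⟩
  have hmsum : ∑ w ∈ N, m w ≤ 2 * (G.degree v / 2) := by
    have h1 : ∑ w ∈ N, m w ≤ G.degree v := by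
      refine (Finset.sum_le_sum hm1).trans ?_
      simp [hN]
    have h2 : Even (∑ w ∈ N, m w) := by
      let K : SimpleGraph V := SimpleGraph.mk (fun a b => G.Adj a b ∧ G.Adj v a ∧ G.Adj v b)
        ⟨fun a b h => ⟨h.1.symm, h.2.2, h.2.1⟩⟩ ⟨fun a h => G.loopless.irrefl a h.1⟩
      have h3 : ∑ w ∈ N, m w = ∑ w, K.degree w := by
        rw [← Finset.sum_subset (Finset.subset_univ N)]
        · refine Finset.sum_congr rfl (fun w hw => ?_)
          rw [← SimpleGraph.card_neighborFinset_eq_degree]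
          simp [hN] at hw
          refine congrArg Finset.card ?_
          ext a
          simp [hN, K, hw, and_comm]
        · intro w _ hw
          simp [hN] at hw
          rw [← SimpleGraph.card_neighborFinset_eq_degree, Finset.card_eq_zero]
          ext a
          simp [K, hw]
      rw [h3, SimpleGraph.sum_degrees_eq_twice_card_edges]
      exact even_two_mul _
    obtain ⟨t, ht⟩ := h2
    omega
  have hT : ∀ w ∈ N, G.minDegree ≤ (T w).card + m w + 1 := by
    intro w hw
    have h1 := G.minDegree_le_degree w
    rw [← SimpleGraph.card_neighborFinset_eq_degree] at h1
    have h2 := Finset.card_sdiff_add_card_inter (G.neighborFinset w) (insert v N)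
    have h3 : (G.neighborFinset w ∩ insert v N) ⊆ insert v (N ∩ G.neighborFinset w) := by
      intro a; simp; tauto
    have h4 := (Finset.card_le_card h3).trans (Finset.card_insert_le _ _)
    simp only [T, m]
    omega
  have hdisj : (N : Set V).PairwiseDisjoint T := by
    intro a ha b hb hab
    rw [Function.onFun, Finset.disjoint_left]
    intro x hxa hxb
    simp [T, hN] at hxa hxb ha hb
    exact hfree ⟨v, a, x, b, fun h => hxa.2.1 h.symm, hab, ha, hxa.1, hxb.1.symm, hb.symm⟩
  have hU : insert v N ∪ N.biUnion T ⊆ Finset.univ.filter (fun u => G.dist v u ≤ 2) := by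
    intro x hx
    simp only [Finset.mem_union, Finset.mem_insert, Finset.mem_biUnion] at hx
    simp only [Finset.mem_filter, Finset.mem_univ, true_and]
    rcases hx with (rfl | hx) | ⟨w, hw, hx⟩
    · simp
    · simp [hN] at hx
      rw [SimpleGraph.dist_eq_one_iff_adj.mpr hx]; omega
    · simp [hN, T] at hx hw
      have h3 : G.dist v x ≤ G.dist v w + G.dist w x := hG.dist_triangle
      rw [SimpleGraph.dist_eq_one_iff_adj.mpr hx.1, SimpleGraph.dist_eq_one_iff_adj.mpr hw] at h3
      exact h3
  have hc := Finset.card_le_card hU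
  rw [Finset.card_union_of_disjoint, Finset.card_biUnion hdisj,
    Finset.card_insert_of_notMem (by simp [hN])] at hc
  · have h5 := Finset.sum_le_sum hT
    rw [Finset.sum_add_distrib, Finset.sum_add_distrib] at h5
    have h6 : N.card = G.degree v := by simp [hN]
    simp only [Finset.sum_const, smul_eq_mul, mul_one, h6] at h5
    omega
  · rw [Finset.disjoint_left]
    intro x hx hx2
    simp only [Finset.mem_biUnion] at hx2
    obtain ⟨w, -, hw⟩ := hx2
    exact (Finset.mem_sdiff.mp hw).2 hx

/-- auxiliary graph joining vertices at distance at most five -/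
def fiveGraph (G : SimpleGraph V) : SimpleGraph V :=
  SimpleGraph.mk (fun a b => a ≠ b ∧ G.dist a b ≤ 5)
    ⟨fun a b h => ⟨h.1.symm, by rw [SimpleGraph.dist_comm]; exact h.2⟩⟩ ⟨fun a h => h.1 rfl⟩

lemma exists_packing (hG : G.Connected) (v1 : V) : ∃ M : Finset V, v1 ∈ M ∧
    (∀ a ∈ M, ∀ b ∈ M, a ≠ b → 5 ≤ G.dist a b) ∧
    ((fiveGraph G).induce (M : Set V)).Connected ∧
    ∀ u, ∃ a ∈ M, G.dist u a ≤ 4 := by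
  classical
  let P : Finset V → Prop := fun M => v1 ∈ M ∧
    (∀ a ∈ M, ∀ b ∈ M, a ≠ b → 5 ≤ G.dist a b) ∧
    ((fiveGraph G).induce (M : Set V)).Connected
  have hP0 : P {v1} := by
    refine ⟨by simp, ?_, ?_⟩
    · intro a ha b hb hab
      simp at ha hb
      exact absurd (ha.trans hb.symm) hab
    · rw [Finset.coe_singleton]
      have : Subsingleton ({v1} : Set V) := inferInstance
      have : Nonempty ({v1} : Set V) := inferInstance
      exact ⟨SimpleGraph.Preconnected.of_subsingleton⟩
  obtain ⟨M, hM, hmax⟩ := Finset.exists_max_image (Finset.univ.filter P) Finset.card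
    ⟨{v1}, by simp [hP0]⟩
  simp only [Finset.mem_filter, Finset.mem_univ, true_and] at hM hmax
  refine ⟨M, hM.1, hM.2.1, hM.2.2, ?_⟩
  by_contra hcon
  push Not at hcon
  obtain ⟨u, hu⟩ := hcon
  obtain ⟨p⟩ := hG.preconnected u v1
  obtain ⟨d, -, hd1, hd2⟩ := p.exists_boundary_dart {x | ∀ a ∈ M, 4 < G.dist x a} hu
    (by simp only [Set.mem_ofPred_eq]; push Not; exact ⟨v1, hM.1, by simp⟩)
  simp only [Set.mem_ofPred_eq] at hd1 hd2
  push Not at hd2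
  obtain ⟨a, ha, hda⟩ := hd2
  set x := d.fst
  have hxa : G.dist x a ≤ 5 := by
    have h3 : G.dist x a ≤ G.dist x d.snd + G.dist d.snd a := hG.dist_triangle
    rw [SimpleGraph.dist_eq_one_iff_adj.mpr d.adj] at h3
    omega
  have hxM : x ∉ M := by
    intro h
    have := hd1 x h
    simp at this
  have hPx : P (insert x M) := by
    refine ⟨by simp [hM.1], ?_, ?_⟩
    · intro b hb c hc hbc
      simp only [Finset.mem_insert] at hb hc
      rcases hb with rfl | hb <;> rcases hc with rfl | hc
      · exact absurd rfl hbc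
      · exact hd1 c hc
      · rw [SimpleGraph.dist_comm]; exact hd1 b hb
      · exact hM.2.1 b hb c hc hbc
    · have hadj : (fiveGraph G).Adj x a := ⟨fun h => hxM (h ▸ ha), hxa⟩
      have h1 := SimpleGraph.induce_union_connected
        (SimpleGraph.induce_pair_connected_of_adj hadj).preconnected hM.2.2.preconnected
        ⟨a, by simp, ha⟩
      have h2 : (({x, a} : Set V) ∪ (M : Set V)) = ((insert x M : Finset V) : Set V) := by
        ext y
        simp only [Set.mem_union, Set.mem_insert_iff, Set.mem_singleton_iff, Finset.mem_coe,
          Finset.mem_insert]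
        constructor
        · rintro ((h | rfl) | h)
          · exact Or.inl h
          · exact Or.inr ha
          · exact Or.inr h
        · rintro (h | h)
          · exact Or.inl (Or.inl h)
          · exact Or.inr h
      rwa [h2] at h1
  have := hmax _ hPx
  rw [Finset.card_insert_of_notMem hxM] at this
  omega

lemma dist_five (hG : G.Connected) (M : Finset V) (a b : (M : Set V))
    (p : ((fiveGraph G).induce (M : Set V)).Walk a b) :
    G.dist (a : V) (b : V) ≤ 5 * p.length := by
  induction p with
  | nil => simp
  | @cons x y z h p ih =>
    have h3 : G.dist (x : V) z ≤ G.dist (x : V) y + G.dist (y : V) z := hG.dist_triangle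
    have h4 : G.dist (x : V) y ≤ 5 := h.2
    simp only [SimpleGraph.Walk.length_cons]
    omega

lemma weighted_sum {W : Type*} [Fintype W] (c e : W → ℝ) (a E : ℝ) (ha : 0 ≤ a)
    (hc : ∀ m, a ≤ c m) (he : ∀ m, e m ≤ E) (n S : ℝ) (hn : ∑ m, c m = n)
    (hS : ∑ m, e m ≤ S) :
    ∑ m, c m * e m ≤ E * (n - Fintype.card W * a) + a * S := by
  have h1 : ∑ m, c m * e m = ∑ m, (c m - a) * e m + a * ∑ m, e m := by
    rw [Finset.mul_sum, ← Finset.sum_add_distrib]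
    exact Finset.sum_congr rfl (fun m _ => by ring)
  have h2 : ∑ m, (c m - a) * e m ≤ ∑ m, (c m - a) * E :=
    Finset.sum_le_sum (fun m _ => mul_le_mul_of_nonneg_left (he m) (sub_nonneg.mpr (hc m)))
  rw [← Finset.sum_mul, Finset.sum_sub_distrib, hn] at h2
  simp only [Finset.sum_const, Finset.card_univ, nsmul_eq_mul] at h2
  have h3 := mul_le_mul_of_nonneg_left hS ha
  linarith

lemma final_ineq (n k a D S : ℝ) (ha : 0 < a) (hD : 0 ≤ D) (hk : 1 ≤ k) (hn : k * a + D ≤ n)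
    (hS : S ≤ (k - 1) * (n - k * a) + a * (3 * k ^ 2 / 4)) :
    (8 * n + 5 * S) / n ≤ (15 / 4) * ((n - D) / a) * (1 + D / (3 * n)) + 37 / 4 := by
  have hka : 0 < k * a := by positivity
  have hn0 : 0 < n := by linarith
  obtain ⟨K, hK⟩ : ∃ K, K = (n - D) / a := ⟨_, rfl⟩
  have hnK : n = a * K + D := by rw [hK]; field_simp; ring
  have hkK : k ≤ K := by rw [hK, le_div_iff₀ ha]; linarith
  rw [← hK, div_le_iff₀ hn0]
  have h1 : (15 / 4 * K * (1 + D / (3 * n)) + 37 / 4) * n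
      = 15 / 4 * K * n + 5 / 4 * K * D + 37 / 4 * n := by
    field_simp; ring
  rw [h1]
  have h2 : S ≤ 3 / 4 * K * n + 1 / 4 * K * D + 1 / 4 * n := by
    refine hS.trans ?_
    have e1 : 0 ≤ a * ((K - k) * (3 * K - k)) :=
      mul_nonneg ha.le (mul_nonneg (by linarith) (by linarith))
    have e2 : 0 ≤ D * (K - k) := mul_nonneg hD (by linarith)
    have e3 : 0 ≤ a * (K - k) := mul_nonneg ha.le (by linarith)
    have e4 : 0 ≤ a * K := mul_nonneg ha.le (by linarith)
    subst hnK
    nlinarith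
  linarith

lemma eps_mono (δ d1 d2 : ℕ) (hδ : 2 ≤ δ) (h : d1 ≤ d2) :
    (d1 : ℝ) * δ - 2 * ((d1 / 2 : ℕ) : ℝ) + 1 ≤ (d2 : ℝ) * δ - 2 * ((d2 / 2 : ℕ) : ℝ) + 1 := by
  have h1 : d1 * δ + 2 * (d2 / 2) ≤ d2 * δ + 2 * (d1 / 2) := by
    obtain ⟨t, rfl⟩ := Nat.exists_eq_add_of_le h
    obtain ⟨s, rfl⟩ := Nat.exists_eq_add_of_le hδ
    rcases Nat.eq_zero_or_pos t with h0 | h0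
    · subst h0; simp
    · have : 2 * ((d1 + t) / 2) ≤ 2 * (d1 / 2) + 2 * t := by omega
      nlinarith
  have h2 : (d1 : ℝ) * δ + 2 * ((d2 / 2 : ℕ) : ℝ) ≤ d2 * δ + 2 * ((d1 / 2 : ℕ) : ℝ) := by
    exact_mod_cast h1
  linarith

lemma main_large [DecidableRel G.Adj] (hG : G.Connected) (hfree : C4Free G)
    (a A : ℝ) (v1 : V) (ha : 0 < a) (haA : a ≤ A)
    (hball : ∀ v, a ≤ ((Finset.univ.filter (fun u => G.dist v u ≤ 2)).card : ℝ))
    (hball1 : A ≤ ((Finset.univ.filter (fun u => G.dist v1 u ≤ 2)).card : ℝ)) :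
    avec G ≤ (15 / 4) * (((Fintype.card V : ℝ) - (A - a)) / a) *
      (1 + (A - a) / (3 * (Fintype.card V : ℝ))) + 37 / 4 := by
  classical
  obtain ⟨M, hv1, hsep, hconn, hcov⟩ := exists_packing hG v1
  set H := (fiveGraph G).induce (M : Set V) with hH
  have hf : ∀ u : V, ∃ m : (M : Set V), G.dist u m ≤ 4 ∧
      ∀ m' : (M : Set V), G.dist u m ≤ G.dist u m' := by
    intro u
    obtain ⟨b, hb, hub⟩ := hcov u
    have : Nonempty (M : Set V) := ⟨⟨b, hb⟩⟩
    obtain ⟨m, hm⟩ := Finite.exists_min (fun m : (M : Set V) => G.dist u m)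
    exact ⟨m, (hm ⟨b, hb⟩).trans hub, hm⟩
  choose f hf4 hfmin using hf
  let c : (↥(M : Set V)) → ℝ := fun m => ((Finset.univ.filter (fun u => f u = m)).card : ℝ)
  have hcball : ∀ m : (M : Set V),
      ((Finset.univ.filter (fun u => G.dist (m : V) u ≤ 2)).card : ℝ) ≤ c m := by
    intro m
    simp only [c]
    refine Nat.cast_le.mpr (Finset.card_le_card ?_)
    intro u hu
    simp only [Finset.mem_filter, Finset.mem_univ, true_and] at hu ⊢
    by_contra hne
    have h1 := hsep m m.2 (f u) (f u).2 (fun h => hne (Subtype.ext h.symm))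
    have h2 := hfmin u m
    have h3 : G.dist (m : V) (f u) ≤ G.dist (m : V) u + G.dist u (f u) := hG.dist_triangle
    rw [dist_comm (u := u) (v := (m : V))] at h2
    omega
  have hcsum : ∑ m, c m = (Fintype.card V : ℝ) := by
    have := Finset.card_eq_sum_card_fiberwise (s := (Finset.univ : Finset V))
      (t := (Finset.univ : Finset (M : Set V))) (f := f) (by simp)
    rw [Finset.card_univ] at this
    rw [this]
    push_cast
    rfl
  have hecc : ∀ u, ecc G u ≤ 8 + 5 * ecc H (f u) := by
    intro u
    refine Finset.sup_le (fun w _ => ?_)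
    obtain ⟨p, hp⟩ := hconn.exists_walk_length_eq_dist (f u) (f w)
    have h1 := dist_five hG M _ _ p
    have h2 := dist_le_ecc (G := H) (f u) (f w)
    have h3 : G.dist u w ≤ G.dist u (f u) + G.dist (f u : V) w := hG.dist_triangle
    have h4 : G.dist (f u : V) w ≤ G.dist (f u : V) (f w) + G.dist (f w : V) w :=
      hG.dist_triangle
    have h5 := hf4 u
    have h6 := hf4 w
    rw [SimpleGraph.dist_comm] at h6
    omega
  have hsum : ∑ u, (ecc G u : ℝ) ≤ 8 * (Fintype.card V : ℝ) + 5 * ∑ m, c m * (ecc H m : ℝ) := by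
    have h1 : ∑ u, (ecc G u : ℝ) ≤ ∑ u, (8 + 5 * (ecc H (f u) : ℝ)) :=
      Finset.sum_le_sum (fun u _ => by exact_mod_cast hecc u)
    have h2 : ∑ u, (ecc H (f u) : ℝ) = ∑ m, c m * (ecc H m : ℝ) := by
      rw [← Finset.sum_fiberwise (Finset.univ : Finset V) f]
      refine Finset.sum_congr rfl (fun m _ => ?_)
      rw [Finset.sum_congr rfl (g := fun _ => (ecc H m : ℝ))]
      · simp [c]
      · intro u hu
        rw [(Finset.mem_filter.mp hu).2]
    rw [Finset.sum_add_distrib, ← Finset.mul_sum, h2] at h1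
    simp only [Finset.sum_const, Finset.card_univ, nsmul_eq_mul] at h1
    linarith
  set k : ℝ := (Fintype.card (M : Set V) : ℝ) with hk
  have hW := weighted_sum c (fun m => (ecc H m : ℝ)) a (k - 1) ha.le
    (fun m => (hball m).trans (hcball m))
    (fun m => by
      have := ecc_lt_card hconn m
      have h2 : (ecc H m : ℝ) + 1 ≤ k := by rw [hk]; exact_mod_cast this
      linarith) _ (3 * k ^ 2 / 4) hcsum
    (by
      have := sum_ecc_le hconn
      have h2 : 4 * ∑ m, (ecc H m : ℝ) ≤ 3 * k ^ 2 := by rw [hk]; exact_mod_cast this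
      linarith)
  have hkn : k * a + (A - a) ≤ (Fintype.card V : ℝ) := by
    rw [← hcsum]
    have h1 : ∑ m : (M : Set V), (a + if m = ⟨v1, hv1⟩ then A - a else 0) ≤ ∑ m, c m := by
      refine Finset.sum_le_sum (fun m _ => ?_)
      split_ifs with h
      · subst h
        have := hball1.trans (hcball ⟨v1, hv1⟩)
        linarith
      · have := (hball m).trans (hcball m)
        linarith
    rw [Finset.sum_add_distrib] at h1
    simpa [hk] using h1
  have hk1 : 1 ≤ k := by
    rw [hk]
    have : Nonempty (M : Set V) := ⟨⟨v1, hv1⟩⟩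
    exact_mod_cast Fintype.card_pos
  refine le_trans ?_ (final_ineq _ k a (A - a) _ ha (by linarith) hk1 hkn hW)
  unfold avec
  exact div_le_div_of_nonneg_right hsum (by positivity)

lemma avec_le (hG : G.Connected) : avec G ≤ (Fintype.card V : ℝ) - 1 := by
  have := hG.nonempty
  have hpos : 0 < (Fintype.card V : ℝ) := by exact_mod_cast Fintype.card_pos
  unfold avec
  rw [div_le_iff₀ hpos]
  calc ∑ v, (ecc G v : ℝ) ≤ ∑ v : V, ((Fintype.card V : ℝ) - 1) :=
        Finset.sum_le_sum (fun v _ => by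
          have : (ecc G v : ℝ) + 1 ≤ Fintype.card V := by exact_mod_cast ecc_lt_card hG v
          linarith)
    _ = _ := by simp; ring

end helpers

theorem stmt5 {V : Type*} [Fintype V] (G : SimpleGraph V) [DecidableRel G.Adj]
    (hG : G.Connected) (hfree : C4Free G)
    (n δ Δ : ℕ) (hn : Fintype.card V = n)
    (hδ : G.minDegree = δ) (hΔ : G.maxDegree = Δ)
    (εΔ εδ : ℝ)
    (hεΔ : εΔ = (Δ : ℝ) * δ - 2 * ((Δ / 2 : ℕ) : ℝ) + 1)
    (hεδ : εδ = (δ : ℝ) * δ - 2 * ((δ / 2 : ℕ) : ℝ) + 1) :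
    avec G ≤ (15 / 4) * (((n : ℝ) - εΔ + εδ) / εδ) * (1 + (εΔ - εδ) / (3 * n)) + 37 / 4 := by
  subst hn hδ hΔ
  have hne := hG.nonempty
  have hpos : 1 ≤ (Fintype.card V : ℝ) := by exact_mod_cast Fintype.card_pos
  by_cases h2 : 2 ≤ G.minDegree
  · obtain ⟨v1, hv1⟩ := G.exists_maximal_degree_vertex
    have hb : ∀ v, (G.degree v : ℝ) * G.minDegree - 2 * ((G.degree v / 2 : ℕ) : ℝ) + 1 ≤
        ((Finset.univ.filter (fun u => G.dist v u ≤ 2)).card : ℝ) := by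
      intro v
      have h := ball_card hG hfree v
      have h' : (G.degree v : ℝ) * G.minDegree + 1 ≤
        ((Finset.univ.filter (fun u => G.dist v u ≤ 2)).card : ℝ)
          + 2 * ((G.degree v / 2 : ℕ) : ℝ) := by exact_mod_cast h
      linarith
    have h := main_large hG hfree εδ εΔ v1 ?_ ?_ ?_ ?_
    · have e : (Fintype.card V : ℝ) - εΔ + εδ = (Fintype.card V : ℝ) - (εΔ - εδ) := by ring
      rw [e]
      exact h
    · have := eps_mono G.minDegree 0 G.minDegree h2 (Nat.zero_le _)
      rw [hεδ]
      simp only [Nat.cast_zero, Nat.zero_div] at this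
      linarith
    · rw [hεδ, hεΔ]
      exact eps_mono _ _ _ h2 G.minDegree_le_maxDegree
    · intro v
      rw [hεδ]
      exact (eps_mono _ _ _ h2 (G.minDegree_le_degree v)).trans (hb v)
    · rw [hεΔ, hv1]
      exact hb v1
  · have hav := avec_le hG
    obtain h0 | h1 : G.minDegree = 0 ∨ G.minDegree = 1 := by omega
    · have hss : ¬ Nontrivial V := by
        intro hnt
        have := hG.preconnected.minDegree_pos_of_nontrivial
        omega
      have hc1 : Fintype.card V ≤ 1 := by
        rw [not_nontrivial_iff_subsingleton] at hss
        exact Fintype.card_le_one_iff_subsingleton.mpr hss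
      have hm := G.maxDegree_lt_card_verts
      have hm0 : G.maxDegree = 0 := by omega
      have hc : (Fintype.card V : ℝ) = 1 := by
        have : (Fintype.card V : ℝ) ≤ 1 := by exact_mod_cast hc1
        linarith
      rw [h0] at hεδ hεΔ
      rw [hm0] at hεΔ
      simp at hεδ hεΔ
      subst hεδ hεΔ
      rw [hc] at hav ⊢
      norm_num at hav ⊢
      linarith
    · rw [h1] at hεδ hεΔ
      norm_num at hεδ hεΔ
      set n : ℝ := (Fintype.card V : ℝ) with hn
      have hpar : εΔ = 2 ∨ εΔ = 1 := by
        rcases Nat.mod_two_eq_zero_or_one G.maxDegree with h | h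
        · right
          have : G.maxDegree = 2 * (G.maxDegree / 2) := by omega
          have h' : (G.maxDegree : ℝ) = 2 * ((G.maxDegree / 2 : ℕ) : ℝ) := by exact_mod_cast this
          linarith
        · left
          have : G.maxDegree = 2 * (G.maxDegree / 2) + 1 := by omega
          have h' : (G.maxDegree : ℝ) = 2 * ((G.maxDegree / 2 : ℕ) : ℝ) + 1 := by
            exact_mod_cast this
          linarith
      have h22 : εδ = 2 := by linarith
      rw [h22]
      rcases hpar with h | h <;> rw [h]
      · norm_num
        linarith
      · have h3 : 1 / (3 * n) ≤ 1 / 3 := by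
          rw [div_le_div_iff₀ (by linarith) (by norm_num)]
          linarith
        have h4 : (1 + (1 - 2) / (3 * n) : ℝ) = 1 - 1 / (3 * n) := by ring
        rw [h4]
        nlinarith [mul_nonneg (by linarith : 0 ≤ n + 1) (sub_nonneg.mpr h3)]
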